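/- The submodules F_0, F_1, …, F_{f_{n+1}} satisfy: (a) 0 = F_0 ⊆ F_1 ⊆ F_2 ⊆ ⋯ ⊆ F_{f_{n+1}} = k[S_n], i.e., they form a k-module filtration of k[S_n]; (b) F_i · t_ℓ ⊆ F_i for each i ∈ {0,1,…,f_{n+1}} and each ℓ ∈ [n]; (c) F_i · (t_ℓ − m_{Q_i,ℓ}) ⊆ F_{i−1} for each i ∈ [f_{n+1}] and each ℓ ∈ [n]. -/

import Mathlib

noncomputable section

namespace OneSidedCycleShuffles

/-- `sw n i` is the simple transposition `s_i ∈ S_n` (1-indexed: it swaps the values `i` and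
`i+1` of `[n] = {1,…,n}`, realized on the carrier `Fin n` via the identification
`x ∈ [n] ↔ ⟨x-1⟩ : Fin n`); it is the junk value `1` unless `i ∈ [n-1]`. -/
def sw (n i : ℕ) : Equiv.Perm (Fin n) :=
  if h : 1 ≤ i ∧ i < n then Equiv.swap ⟨i - 1, by omega⟩ ⟨i, h.2⟩ else 1

/-- `cyc n l j` is the cycle `cyc_{l,l+1,…,j} ∈ S_n` (sending `l,…,j-1,j` to `l+1,…,j,l`),
written as the product `s_l s_{l+1} ⋯ s_{j-1}` of simple transpositions. -/
def cyc (n l j : ℕ) : Equiv.Perm (Fin n) :=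
  ((List.range' l (j - l)).map (sw n)).prod

/-- The somewhere-to-below shuffle `t_ℓ = cyc_ℓ + cyc_{ℓ,ℓ+1} + ⋯ + cyc_{ℓ,ℓ+1,…,n} ∈ k[S_n]`. -/
def t (n : ℕ) (k : Type*) [CommRing k] (l : ℕ) : MonoidAlgebra k (Equiv.Perm (Fin n)) :=
  ∑ j ∈ Finset.Icc l n, MonoidAlgebra.of k (Equiv.Perm (Fin n)) (cyc n l j)

/-- `m_{I,ℓ}` : (the smallest element of the enclosure `{0} ∪ I ∪ {n+1}` that is `≥ ℓ`) `- ℓ`. -/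
def mIdx (n : ℕ) (I : Finset ℕ) (l : ℕ) : ℕ :=
  sInf {x : ℕ | (x = 0 ∨ x ∈ I ∨ x = n + 1) ∧ l ≤ x} - l

/-- The non-shadow `I' = [n-1] \ (I ∪ (I-1))`. -/
def nonShadow (n : ℕ) (I : Finset ℕ) : Finset ℕ :=
  Finset.Icc 1 (n - 1) \ (I ∪ I.image (fun i => i - 1))

/-- A set of integers is lacunar if it contains no two consecutive integers. -/
def Lacunar (I : Finset ℕ) : Prop := ∀ i ∈ I, i + 1 ∉ I

instance : DecidablePred Lacunar := fun I =>
  decidable_of_iff (∀ i ∈ I, i + 1 ∉ I) Iff.rfl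

/-- The invariant space `F(I) = {q ∈ k[S_n] : q s_i = q for all i ∈ I'}`. -/
def F (n : ℕ) (k : Type*) [CommRing k] (I : Finset ℕ) :
    Submodule k (MonoidAlgebra k (Equiv.Perm (Fin n))) where
  carrier := {q | ∀ i ∈ nonShadow n I, q * MonoidAlgebra.of k (Equiv.Perm (Fin n)) (sw n i) = q}
  add_mem' := by
    intro a b ha hb i hi
    rw [add_mul, ha i hi, hb i hi]
  zero_mem' := by
    intro i hi
    rw [zero_mul]
  smul_mem' := by
    intro c a ha i hi
    rw [smul_mul_assoc, ha i hi]

/-- `F(<c) = ∑_{J ⊆ [n], sum J < c} F(J)`. -/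
def Flt (n : ℕ) (k : Type*) [CommRing k] (c : ℕ) :
    Submodule k (MonoidAlgebra k (Equiv.Perm (Fin n))) :=
  ∑ J ∈ (Finset.Icc 1 n).powerset.filter (fun J => J.sum id < c), F n k J

/-- `F_i = F(Q_1) + ⋯ + F(Q_i)` for an enumeration `Q` of the lacunar subsets of `[n-1]`. -/
def Fi (n : ℕ) (k : Type*) [CommRing k] (Q : ℕ → Finset ℕ) (i : ℕ) :
    Submodule k (MonoidAlgebra k (Equiv.Perm (Fin n))) :=
  ∑ j ∈ Finset.Icc 1 i, F n k (Q j)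

/-- The (1-indexed) value `w(i) ∈ [n]` of a permutation `w ∈ S_n` at `i ∈ [n]`
(junk value `0` if out of range). -/
def pval (n : ℕ) (w : Equiv.Perm (Fin n)) (i : ℕ) : ℕ :=
  if h : i - 1 < n then (w ⟨i - 1, h⟩).val + 1 else 0

/-- The descent set `Des w = {i ∈ [n-1] : w(i) > w(i+1)}`. -/
def Des (n : ℕ) (w : Equiv.Perm (Fin n)) : Finset ℕ :=
  (Finset.Icc 1 (n - 1)).filter fun i => pval n w (i + 1) < pval n w i

/-- `G(T)` : the subgroup of `S_n` generated by the simple transpositions `s_i`, `i ∈ T`. -/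
def G (n : ℕ) (T : Finset ℕ) : Subgroup (Equiv.Perm (Fin n)) :=
  Subgroup.closure ((T.image (sw n) : Finset (Equiv.Perm (Fin n))) : Set (Equiv.Perm (Fin n)))

open scoped Classical in
/-- `a_w = ∑_{σ ∈ G(Des w)} wσ ∈ k[S_n]`. -/
def aw (n : ℕ) (k : Type*) [CommRing k] (w : Equiv.Perm (Fin n)) :
    MonoidAlgebra k (Equiv.Perm (Fin n)) :=
  ∑ σ ∈ Finset.univ.filter (fun σ => σ ∈ G n (Des n w)),
    MonoidAlgebra.of k (Equiv.Perm (Fin n)) (w * σ)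

/-- The Q-index of `w` : the smallest `i ∈ [f_{n+1}]` with `Q_i' ⊆ Des w`. -/
def Qind (n : ℕ) (Q : ℕ → Finset ℕ) (w : Equiv.Perm (Fin n)) : ℕ :=
  sInf {i : ℕ | 1 ≤ i ∧ i ≤ Nat.fib (n + 1) ∧ nonShadow n (Q i) ⊆ Des n w}

/-- The set of inversions of `u ∈ S_n` : pairs `(i,j) ∈ [n] × [n]` with `i < j`, `u(i) > u(j)`. -/
def InvSet (n : ℕ) (u : Equiv.Perm (Fin n)) : Finset (ℕ × ℕ) :=
  (Finset.Icc 1 n ×ˢ Finset.Icc 1 n).filter fun p => p.1 < p.2 ∧ pval n u p.2 < pval n u p.1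

/-- The lexicographic order on `S_n` : `u < v` iff at the smallest `i ∈ [n]` where they
differ, `u(i) < v(i)`. -/
def lexLT (n : ℕ) (u v : Equiv.Perm (Fin n)) : Prop :=
  ∃ i ∈ Finset.Icc 1 n, pval n u i < pval n v i ∧
    ∀ j ∈ Finset.Icc 1 n, j < i → pval n u j = pval n v j

/-- `Z(I) = {q ∈ k[S_n] : q s_i = q for all i ∈ I}`. -/
def Z (n : ℕ) (k : Type*) [CommRing k] (I : Finset ℕ) :
    Submodule k (MonoidAlgebra k (Equiv.Perm (Fin n))) where
  carrier := {q | ∀ i ∈ I, q * MonoidAlgebra.of k (Equiv.Perm (Fin n)) (sw n i) = q}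
  add_mem' := by
    intro a b ha hb i hi
    rw [add_mul, ha i hi, hb i hi]
  zero_mem' := by
    intro i hi
    rw [zero_mul]
  smul_mem' := by
    intro c a ha i hi
    rw [smul_mul_assoc, ha i hi]

/-- `R(x)` : right multiplication by `x`, as a `k`-module endomorphism of `k[S_n]`. -/
def Rmul (n : ℕ) (k : Type*) [CommRing k] (x : MonoidAlgebra k (Equiv.Perm (Fin n))) :
    Module.End k (MonoidAlgebra k (Equiv.Perm (Fin n))) :=
  LinearMap.mulRight k x


theorem sw_mul_self (n i : ℕ) : sw n i * sw n i = 1 := by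
  unfold sw
  split_ifs <;> simp

theorem sw_commute {n i j : ℕ} (h : i + 1 < j) : sw n i * sw n j = sw n j * sw n i := by
  unfold sw
  split_ifs with h₁ h₂ h₂
  · refine (Equiv.Perm.Disjoint.commute ?_).eq
    apply Equiv.Perm.disjoint_swap_swap
    simp only [List.nodup_cons, List.mem_cons, Fin.mk.injEq, List.not_mem_nil, or_false,
      not_false_eq_true, List.nodup_nil, and_true]
    omega
  all_goals simp

theorem sw_braid {n i : ℕ} (h : 1 ≤ i) (hn : i + 1 < n) :
    sw n i * sw n (i + 1) * sw n i = sw n (i + 1) * sw n i * sw n (i + 1) := by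
  have h₁ : 1 ≤ i ∧ i < n := by omega
  have h₂ : 1 ≤ i + 1 ∧ i + 1 < n := by omega
  simp only [sw, dif_pos h₁, dif_pos h₂, Nat.add_sub_cancel]
  have hab : (⟨i - 1, by omega⟩ : Fin n) ≠ ⟨i, h₁.2⟩ := by
    rw [Ne, Fin.mk.injEq]; omega
  have hac : (⟨i - 1, by omega⟩ : Fin n) ≠ ⟨i + 1, h₂.2⟩ := by
    rw [Ne, Fin.mk.injEq]; omega
  have hbc : (⟨i, h₁.2⟩ : Fin n) ≠ ⟨i + 1, h₂.2⟩ := by simp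
  generalize (⟨i - 1, by omega⟩ : Fin n) = a at *
  generalize (⟨i, h₁.2⟩ : Fin n) = b at *
  generalize (⟨i + 1, h₂.2⟩ : Fin n) = c at *
  rw [Equiv.swap_mul_swap_mul_swap hab hac, Equiv.swap_comm a b, Equiv.swap_comm b c,
    Equiv.swap_mul_swap_mul_swap hbc.symm hac.symm, Equiv.swap_comm]

theorem cyc_self (n l : ℕ) : cyc n l l = 1 := by
  simp [cyc]

theorem cyc_succ {n l j : ℕ} (h : l ≤ j) : cyc n l (j + 1) = cyc n l j * sw n j := by
  have h₁ : j + 1 - l = (j - l) + 1 := by omega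
  have h₂ : l + (j - l) = j := by omega
  simp [cyc, h₁, List.range'_concat, h₂]

theorem cyc_mul_cyc {n l m j : ℕ} (h : l ≤ m) (h' : m ≤ j) :
    cyc n l m * cyc n m j = cyc n l j := by
  induction j, h' using Nat.le_induction with
  | base => rw [cyc_self, mul_one]
  | succ j hj ih => rw [cyc_succ hj, cyc_succ (h.trans hj), ← mul_assoc, ih]

theorem cyc_mul_sw_of_add_one_lt {n l j i : ℕ} (h : l ≤ j) (hi : i + 1 < l) :
    cyc n l j * sw n i = sw n i * cyc n l j := by
  induction j, h using Nat.le_induction with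
  | base => simp [cyc_self]
  | succ j hj ih =>
    rw [cyc_succ hj, mul_assoc, ← sw_commute (by omega : i + 1 < j), ← mul_assoc, ih, mul_assoc]

theorem cyc_mul_sw_of_lt {n l j i : ℕ} (h : l ≤ j) (hi : j < i) :
    cyc n l j * sw n i = sw n i * cyc n l j := by
  induction j, h using Nat.le_induction with
  | base => simp [cyc_self]
  | succ j hj ih =>
    rw [cyc_succ hj, mul_assoc, sw_commute hi, ← mul_assoc, ih (by omega), mul_assoc]

theorem cyc_mul_sw_of_add_two_le {n l j i : ℕ} (hl : 1 ≤ l) (h : l ≤ i) (hi : i + 2 ≤ j)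
    (hj : j ≤ n) : cyc n l j * sw n i = sw n (i + 1) * cyc n l j := by
  induction j, hi using Nat.le_induction with
  | base =>
    rw [cyc_succ (by omega), cyc_succ h, mul_assoc, mul_assoc, ← mul_assoc (sw n i),
      sw_braid (by omega) (by omega), ← mul_assoc, ← mul_assoc,
      cyc_mul_sw_of_lt h (by omega : i < i + 1)]
    simp only [mul_assoc]
  | succ j hij ih =>
    rw [cyc_succ (by omega), mul_assoc, ← sw_commute (by omega : i + 1 < j), ← mul_assoc,
      ih (by omega), mul_assoc]

theorem mem_nonShadow {n : ℕ} {I : Finset ℕ} {i : ℕ} :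
    i ∈ nonShadow n I ↔ 1 ≤ i ∧ i < n ∧ i ∉ I ∧ i + 1 ∉ I := by
  simp only [nonShadow, Finset.mem_sdiff, Finset.mem_Icc, Finset.mem_union, Finset.mem_image,
    not_or, not_exists, not_and]
  constructor
  · rintro ⟨⟨h₁, h₂⟩, h₃, h₄⟩
    exact ⟨h₁, by omega, h₃, fun h => h₄ _ h (by omega)⟩
  · rintro ⟨h₁, h₂, h₃, h₄⟩
    refine ⟨⟨h₁, by omega⟩, h₃, fun x hx hxi => h₄ ?_⟩
    rwa [show i + 1 = x by omega]

section GroupAlgebra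

variable {n : ℕ} {k : Type*} [CommRing k]

theorem mem_F {I : Finset ℕ} {q : MonoidAlgebra k (Equiv.Perm (Fin n))} :
    q ∈ F n k I ↔ ∀ i ∈ nonShadow n I, q * MonoidAlgebra.of k _ (sw n i) = q :=
  Iff.rfl

theorem F_mono {I J : Finset ℕ} (h : nonShadow n J ⊆ nonShadow n I) : F n k I ≤ F n k J :=
  fun _ hq i hi => hq i (h hi)

theorem mul_of_mul_of_eq_self {a : MonoidAlgebra k (Equiv.Perm (Fin n))}
    {g s s' : Equiv.Perm (Fin n)} (h : g * s = s' * g)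
    (ha : a * MonoidAlgebra.of k _ s' = a) :
    a * MonoidAlgebra.of k _ g * MonoidAlgebra.of k _ s = a * MonoidAlgebra.of k _ g := by
  rw [mul_assoc, ← map_mul, h, map_mul, ← mul_assoc, ha]

/-- `q · cyc_{l,…,m} = q` when all `s_l, …, s_{m-1}` fix `q`. -/
theorem mul_cyc_eq_self {I : Finset ℕ} {a : MonoidAlgebra k (Equiv.Perm (Fin n))}
    (ha : a ∈ F n k I) {l m : ℕ} (hlm : l ≤ m)
    (h : ∀ i, l ≤ i → i < m → i ∈ nonShadow n I) :
    a * MonoidAlgebra.of k _ (cyc n l m) = a := by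
  induction m, hlm using Nat.le_induction with
  | base => rw [cyc_self, map_one, mul_one]
  | succ m hm ih =>
    rw [cyc_succ hm, map_mul, ← mul_assoc, ih fun i h₁ h₂ => h i h₁ (by omega)]
    exact ha m (h m hm (by omega))

/-- The set obtained from `I` by decrementing the elements of `I ∩ [p, u]`. -/
def decr (I : Finset ℕ) (p u : ℕ) : Finset ℕ :=
  I.image fun x => if p ≤ x ∧ x ≤ u then x - 1 else x

theorem mem_decr_of_not {I : Finset ℕ} {p u x : ℕ} (hx : x ∈ I) (h : x < p ∨ u < x) :
    x ∈ decr I p u :=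
  Finset.mem_image.2 ⟨x, hx, if_neg (by omega)⟩

theorem mem_decr_of_mem {I : Finset ℕ} {p u x : ℕ} (hx : x + 1 ∈ I) (h : p ≤ x + 1)
    (h' : x + 1 ≤ u) : x ∈ decr I p u := by
  refine Finset.mem_image.2 ⟨x + 1, hx, ?_⟩
  rw [if_pos ⟨h, h'⟩, Nat.add_sub_cancel]

theorem sum_decr_lt {I : Finset ℕ} {p u : ℕ} (hp : p ∈ I) (hp' : 1 ≤ p) (hpu : p ≤ u) :
    (decr I p u).sum id < I.sum id := by
  refine (Finset.sum_image_le_of_nonneg (fun _ _ => Nat.zero_le _)).trans_lt ?_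
  refine Finset.sum_lt_sum (fun x _ => ?_) ⟨p, hp, ?_⟩
  · simp only [id]
    split_ifs <;> omega
  · simp only [id]
    rw [if_pos ⟨le_rfl, hpu⟩]
    omega

/-- The part of `a · t_l` coming from the block `[u, v)` between consecutive elements of `I`
lies in `F(J)`, where `J` decrements the elements of `I ∩ [p, u]`. -/
theorem mul_sum_cyc_mem_F_decr {I : Finset ℕ} {a : MonoidAlgebra k (Equiv.Perm (Fin n))}
    (ha : a ∈ F n k I) {l p u v : ℕ} (hl : 1 ≤ l) (hp : p ∈ I) (hlp : l = p ∨ l + 1 = p)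
    (hpu : p ≤ u) (hu : u ∈ I) (huv : u < v) (hv : v ∈ I ∨ v = n + 1) (hvn : v ≤ n + 1)
    (hgap : ∀ x, u < x → x < v → x ∉ I) :
    a * ∑ j ∈ Finset.Ico u v, MonoidAlgebra.of k _ (cyc n l j) ∈ F n k (decr I p u) := by
  rw [Finset.mul_sum, mem_F]
  intro i hi
  obtain ⟨hi₁, hin, hiJ, hiJ'⟩ := mem_nonShadow.1 hi
  rw [Finset.sum_mul]
  have hil : i + 1 ≠ l := by
    intro h
    rcases hlp with rfl | rfl
    · exact hiJ (mem_decr_of_mem (h ▸ hp) (by omega) (by omega))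
    · exact hiJ' (mem_decr_of_mem (h ▸ hp) (by omega) (by omega))
  have hiu : i + 1 ≠ u := by
    intro h
    exact hiJ (mem_decr_of_mem (h ▸ hu) (by omega) (by omega))
  have hiv : i + 1 ≠ v := by
    intro h
    rcases hv with hv | hv
    · exact hiJ' (mem_decr_of_not (h ▸ hv) (by omega))
    · omega
  rcases lt_or_ge (i + 1) l with h | h
  · have hs : a * MonoidAlgebra.of k _ (sw n i) = a := ha i <| mem_nonShadow.2
      ⟨hi₁, hin, fun hI => hiJ (mem_decr_of_not hI (by omega)),
        fun hI => hiJ' (mem_decr_of_not hI (by omega))⟩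
    refine Finset.sum_congr rfl fun j hj => mul_of_mul_of_eq_self ?_ hs
    rw [Finset.mem_Ico] at hj
    exact cyc_mul_sw_of_add_one_lt (by omega) h
  rcases lt_or_ge (i + 1) u with h' | h'
  · have hs : a * MonoidAlgebra.of k _ (sw n (i + 1)) = a := ha (i + 1) <| mem_nonShadow.2
      ⟨by omega, by omega, fun hI => hiJ (mem_decr_of_mem hI (by omega) (by omega)),
        fun hI => hiJ' (mem_decr_of_mem hI (by omega) (by omega))⟩
    refine Finset.sum_congr rfl fun j hj => mul_of_mul_of_eq_self ?_ hs
    rw [Finset.mem_Ico] at hj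
    exact cyc_mul_sw_of_add_two_le hl (by omega) (by omega) (by omega)
  rcases lt_or_ge i v with h'' | h''
  · refine Finset.sum_equiv (Equiv.swap i (i + 1)) (fun j => ?_) (fun j hj => ?_)
    · rw [Finset.mem_Ico, Finset.mem_Ico, Equiv.swap_apply_def]
      split_ifs <;> omega
    rw [Finset.mem_Ico] at hj
    rw [Equiv.swap_apply_def]
    split_ifs with h₁ h₂
    · rw [h₁, cyc_succ (by omega), map_mul, mul_assoc]
    · rw [h₂, cyc_succ (by omega), mul_assoc, ← map_mul, mul_assoc, sw_mul_self, mul_one]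
    · rcases lt_or_ge j i with hji | hji
      · refine mul_of_mul_of_eq_self (cyc_mul_sw_of_lt (by omega) hji) ?_
        exact ha i <| mem_nonShadow.2
          ⟨hi₁, hin, hgap _ (by omega) (by omega), hgap _ (by omega) (by omega)⟩
      · refine mul_of_mul_of_eq_self
          (cyc_mul_sw_of_add_two_le hl (by omega) (by omega) (by omega)) ?_
        exact ha (i + 1) <| mem_nonShadow.2
          ⟨by omega, by omega, hgap _ (by omega) (by omega), hgap _ (by omega) (by omega)⟩
  · have hs : a * MonoidAlgebra.of k _ (sw n i) = a := ha i <| mem_nonShadow.2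
      ⟨hi₁, hin, fun hI => hiJ (mem_decr_of_not hI (by omega)),
        fun hI => hiJ' (mem_decr_of_not hI (by omega))⟩
    refine Finset.sum_congr rfl fun j hj => mul_of_mul_of_eq_self ?_ hs
    rw [Finset.mem_Ico] at hj
    exact cyc_mul_sw_of_lt (by omega) (by omega)

theorem mul_sum_Ico_cyc_mem {I : Finset ℕ} (hI : I ⊆ Finset.Icc 1 n)
    {M : Submodule k (MonoidAlgebra k (Equiv.Perm (Fin n)))}
    (hM : ∀ J : Finset ℕ, J.sum id < I.sum id → F n k J ≤ M)
    {a : MonoidAlgebra k (Equiv.Perm (Fin n))} (ha : a ∈ F n k I)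
    {l p : ℕ} (hl : 1 ≤ l) (hp : p ∈ I) (hlp : l = p ∨ l + 1 = p)
    {v : ℕ} (hpv : p ≤ v) (hv : v ∈ I ∨ v = n + 1) :
    a * ∑ j ∈ Finset.Ico p v, MonoidAlgebra.of k _ (cyc n l j) ∈ M := by
  induction v using Nat.strong_induction_on with
  | _ v ih =>
  rcases hpv.eq_or_lt with rfl | hlt
  · simp
  have hvn : v ≤ n + 1 := by
    rcases hv with hv | hv
    · have := Finset.mem_Icc.1 (hI hv)
      omega
    · omega
  have hne : (I.filter (· < v)).Nonempty := ⟨p, Finset.mem_filter.2 ⟨hp, hlt⟩⟩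
  obtain ⟨u, hu, hmax⟩ := (I.filter (· < v)).exists_max_image id hne
  rw [Finset.mem_filter] at hu
  have hpu : p ≤ u := hmax p (Finset.mem_filter.2 ⟨hp, hlt⟩)
  rw [← Finset.sum_Ico_consecutive _ hpu hu.2.le, mul_add]
  refine M.add_mem (ih u hu.2 hpu (Or.inl hu.1)) (hM _ (sum_decr_lt hp (by omega) hpu) ?_)
  refine mul_sum_cyc_mem_F_decr ha hl hp hlp hpu hu.1 hu.2 hv hvn fun x hux hxv hx => ?_
  have : x ≤ u := hmax x (Finset.mem_filter.2 ⟨hx, hxv⟩)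
  omega

/-- `F(I) · (t_l - m_{I,l})` lies in every submodule that contains all `F(J)` with
`sum J < sum I`. -/
theorem mul_t_sub_mIdx_mem {I : Finset ℕ} (hI : I ⊆ Finset.Icc 1 n)
    {M : Submodule k (MonoidAlgebra k (Equiv.Perm (Fin n)))}
    (hM : ∀ J : Finset ℕ, J.sum id < I.sum id → F n k J ≤ M)
    {a : MonoidAlgebra k (Equiv.Perm (Fin n))} (ha : a ∈ F n k I)
    {l : ℕ} (hl : l ∈ Finset.Icc 1 n) :
    a * (t n k l - (mIdx n I l : MonoidAlgebra k (Equiv.Perm (Fin n)))) ∈ M := by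
  rw [Finset.mem_Icc] at hl
  obtain ⟨p, hp, hlp, hpm, hmin⟩ : ∃ p, (p ∈ I ∨ p = n + 1) ∧ l ≤ p ∧ mIdx n I l = p - l ∧
      ∀ x, l ≤ x → x < p → x ∉ I := by
    have hmem := Nat.sInf_mem (s := {x : ℕ | (x = 0 ∨ x ∈ I ∨ x = n + 1) ∧ l ≤ x})
      ⟨n + 1, Or.inr (Or.inr rfl), by omega⟩
    refine ⟨_, ?_, hmem.2, rfl, fun x hlx hx hxI => ?_⟩
    · rcases hmem.1 with h | h
      · have := hmem.2
        omega
      · exact h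
    · exact Nat.notMem_of_lt_sInf hx ⟨Or.inr (Or.inl hxI), hlx⟩
  have hpn : p ≤ n + 1 := by
    rcases hp with hp | hp
    · have := Finset.mem_Icc.1 (hI hp)
      omega
    · omega
  have hns : ∀ i, l ≤ i → i + 1 < p → i ∈ nonShadow n I := fun i h₁ h₂ =>
    mem_nonShadow.2 ⟨by omega, by omega, hmin i h₁ (by omega), hmin _ (by omega) h₂⟩
  have hfix : ∀ m, l ≤ m → m < p → a * MonoidAlgebra.of k _ (cyc n l m) = a := fun m h₁ h₂ =>
    mul_cyc_eq_self ha h₁ fun i h₃ h₄ => hns i h₃ (by omega)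
  have hsplit : a * (t n k l - (mIdx n I l : MonoidAlgebra k (Equiv.Perm (Fin n)))) =
      a * ∑ j ∈ Finset.Ico p (n + 1), MonoidAlgebra.of k _ (cyc n l j) := by
    have ht : t n k l = ∑ j ∈ Finset.Ico l (n + 1), MonoidAlgebra.of k _ (cyc n l j) := rfl
    rw [ht, ← Finset.sum_Ico_consecutive _ hlp hpn, mul_sub, mul_add, Finset.mul_sum,
      Finset.sum_congr rfl fun j hj =>
        hfix j (Finset.mem_Ico.1 hj).1 (Finset.mem_Ico.1 hj).2, Finset.sum_const, Nat.card_Ico,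
      hpm, nsmul_eq_mul, (Nat.cast_commute (p - l) a).eq, add_sub_cancel_left]
  rw [hsplit]
  rcases hp with hp | rfl
  · rcases hlp.eq_or_lt with rfl | hlt
    · exact mul_sum_Ico_cyc_mem hI hM ha hl.1 hp (Or.inl rfl) hpn (Or.inr rfl)
    · have := mul_sum_Ico_cyc_mem hI hM ha (l := p - 1) (by omega) hp (Or.inr (by omega)) hpn
        (Or.inr rfl)
      convert this using 1
      rw [Finset.mul_sum, Finset.mul_sum]
      refine Finset.sum_congr rfl fun j hj => ?_
      rw [Finset.mem_Ico] at hj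
      rw [← cyc_mul_cyc (by omega : l ≤ p - 1) (by omega : p - 1 ≤ j), map_mul, ← mul_assoc,
        hfix _ (by omega) (by omega)]
  · simp

end GroupAlgebra

theorem sum_insert_erase_lt {J : Finset ℕ} {x y : ℕ} (hx : x ∈ J) (hyx : y < x) :
    (insert y (J.erase x)).sum id < J.sum id := by
  have h₁ : (J.erase x).sum id + x = J.sum id := Finset.sum_erase_add J id hx
  have h₂ : (insert y (J.erase x)).sum id ≤ y + (J.erase x).sum id := by
    by_cases hy : y ∈ J.erase x
    · rw [Finset.insert_eq_of_mem hy]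
      omega
    · rw [Finset.sum_insert hy]
      rfl
  omega

/-- Every set is dominated by a lacunar subset of `[n-1]` with a larger shadow. -/
theorem exists_lacunar_nonShadow_subset (n : ℕ) (J : Finset ℕ) :
    ∃ K : Finset ℕ, K ⊆ Finset.Icc 1 (n - 1) ∧ Lacunar K ∧ K.sum id ≤ J.sum id ∧
      nonShadow n K ⊆ nonShadow n J := by
  induction hs : J.sum id using Nat.strong_induction_on generalizing J with
  | _ s ih =>
  subst hs
  suffices h : (∃ x ∈ J, ∃ y < x, nonShadow n (insert y (J.erase x)) ⊆ nonShadow n J) ∨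
      (J.erase 0 ⊆ Finset.Icc 1 (n - 1) ∧ Lacunar (J.erase 0)) by
    rcases h with ⟨x, hx, y, hyx, hns⟩ | ⟨h₁, h₂⟩
    · have hlt := sum_insert_erase_lt hx hyx
      obtain ⟨K, hK, hKl, hKs, hKn⟩ := ih _ hlt _ rfl
      exact ⟨K, hK, hKl, hKs.trans hlt.le, hKn.trans hns⟩
    · refine ⟨J.erase 0, h₁, h₂, Finset.sum_le_sum_of_subset (Finset.erase_subset _ _), ?_⟩
      intro i hi
      rw [mem_nonShadow, Finset.mem_erase, Finset.mem_erase] at hi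
      rw [mem_nonShadow]
      exact ⟨hi.1, hi.2.1, fun h => hi.2.2.1 ⟨by omega, h⟩, fun h => hi.2.2.2 ⟨by omega, h⟩⟩
  by_cases hsub : J.erase 0 ⊆ Finset.Icc 1 (n - 1)
  · by_cases hlac : Lacunar (J.erase 0)
    · exact Or.inr ⟨hsub, hlac⟩
    · simp only [Lacunar, not_forall, not_not] at hlac
      obtain ⟨x, hx, hx'⟩ := hlac
      rw [Finset.mem_erase] at hx hx'
      refine Or.inl ⟨x, hx.2, x - 1, by omega, fun i hi => ?_⟩
      simp only [mem_nonShadow, Finset.mem_insert, Finset.mem_erase, not_or, not_and] at hi ⊢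
      grind
  · obtain ⟨x, hx, hx'⟩ := Finset.not_subset.1 hsub
    rw [Finset.mem_erase] at hx
    rw [Finset.mem_Icc] at hx'
    refine Or.inl ⟨x, hx.2, x - 1, by omega, fun i hi => ?_⟩
    simp only [mem_nonShadow, Finset.mem_insert, Finset.mem_erase, not_or, not_and] at hi ⊢
    grind

/-- Theorem `thm.t-simultri`. Given an enumeration `Q_1, …, Q_{f_{n+1}}`
(without repetition) of all lacunar subsets of `[n-1]`, listed with weakly increasing element
sums, and setting `F_i := F(Q_1) + ⋯ + F(Q_i)`:
(a) `0 = F_0 ⊆ F_1 ⊆ ⋯ ⊆ F_{f_{n+1}} = k[S_n]`;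
(b) `F_i · t_ℓ ⊆ F_i` for all `0 ≤ i ≤ f_{n+1}` and `ℓ ∈ [n]`;
(c) `F_i · (t_ℓ − m_{Q_i,ℓ}) ⊆ F_{i-1}` for all `i ∈ [f_{n+1}]` and `ℓ ∈ [n]`. -/
theorem fibonacci_filtration (n : ℕ) (k : Type*) [CommRing k]
    (Q : ℕ → Finset ℕ)
    (hQlac : ∀ i ∈ Finset.Icc 1 (Nat.fib (n + 1)),
      Q i ⊆ Finset.Icc 1 (n - 1) ∧ Lacunar (Q i))
    (hQbij : ∀ J : Finset ℕ, J ⊆ Finset.Icc 1 (n - 1) → Lacunar J →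
      ∃! i, i ∈ Finset.Icc 1 (Nat.fib (n + 1)) ∧ Q i = J)
    (hQmono : ∀ i ∈ Finset.Icc 1 (Nat.fib (n + 1)), ∀ j ∈ Finset.Icc 1 (Nat.fib (n + 1)),
      i ≤ j → (Q i).sum id ≤ (Q j).sum id) :
    (Fi n k Q 0 = ⊥ ∧ (∀ i j : ℕ, i ≤ j → Fi n k Q i ≤ Fi n k Q j) ∧
        Fi n k Q (Nat.fib (n + 1)) = ⊤) ∧
    (∀ i ≤ Nat.fib (n + 1), ∀ l ∈ Finset.Icc 1 n,
      ∀ q ∈ Fi n k Q i, q * t n k l ∈ Fi n k Q i) ∧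
    (∀ i ∈ Finset.Icc 1 (Nat.fib (n + 1)), ∀ l ∈ Finset.Icc 1 n,
      ∀ q ∈ Fi n k Q i,
        q * (t n k l - (mIdx n (Q i) l : MonoidAlgebra k (Equiv.Perm (Fin n)))) ∈
          Fi n k Q (i - 1)) := by
  have hmono : ∀ i j : ℕ, i ≤ j → Fi n k Q i ≤ Fi n k Q j := fun i j hij =>
    Finset.sum_le_sum_of_subset (Finset.Icc_subset_Icc le_rfl hij)
  have hle : ∀ i j, 1 ≤ j → j ≤ i → F n k (Q j) ≤ Fi n k Q i := fun i j h₁ h₂ =>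
    Finset.single_le_sum (f := fun j => F n k (Q j)) (fun _ _ => bot_le)
      (Finset.mem_Icc.2 ⟨h₁, h₂⟩)
  have hsucc : ∀ i, Fi n k Q (i + 1) = Fi n k Q i ⊔ F n k (Q (i + 1)) := fun i =>
    Finset.sum_Icc_succ_top (by omega) _
  have hstep : ∀ i ∈ Finset.Icc 1 (Nat.fib (n + 1)), ∀ l ∈ Finset.Icc 1 n,
      ∀ q ∈ F n k (Q i),
        q * (t n k l - (mIdx n (Q i) l : MonoidAlgebra k (Equiv.Perm (Fin n)))) ∈
          Fi n k Q (i - 1) := by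
    intro i hi l hl q hq
    refine mul_t_sub_mIdx_mem
      ((hQlac i hi).1.trans (Finset.Icc_subset_Icc le_rfl (Nat.sub_le _ _))) ?_ hq hl
    intro J hJ
    obtain ⟨K, hK, hKl, hKs, hKn⟩ := exists_lacunar_nonShadow_subset n J
    obtain ⟨j, ⟨hj, rfl⟩, -⟩ := hQbij K hK hKl
    have hji : j < i := by
      by_contra! h
      have := hQmono i hi j hj h
      omega
    exact (F_mono hKn).trans (hle _ _ (Finset.mem_Icc.1 hj).1 (by omega))
  have hmulCast : ∀ (M : Submodule k (MonoidAlgebra k (Equiv.Perm (Fin n))))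
      (q : MonoidAlgebra k (Equiv.Perm (Fin n))) (m : ℕ), q ∈ M →
      q * (m : MonoidAlgebra k (Equiv.Perm (Fin n))) ∈ M := by
    intro M q m hq
    rw [← (Nat.cast_commute m q).eq, ← nsmul_eq_mul]
    exact M.nsmul_mem hq m
  have hinv : ∀ i ≤ Nat.fib (n + 1), ∀ l ∈ Finset.Icc 1 n,
      ∀ q ∈ Fi n k Q i, q * t n k l ∈ Fi n k Q i := by
    intro i
    induction i with
    | zero =>
      intro _ l _ q hq
      obtain rfl : q = 0 := by simpa [Fi] using hq
      simp
    | succ i ih =>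
      intro hi l hl q hq
      rw [hsucc] at hq
      obtain ⟨q₁, hq₁, q₂, hq₂, rfl⟩ := Submodule.mem_sup.1 hq
      rw [add_mul]
      refine add_mem (hmono i _ (by omega) (ih (by omega) l hl q₁ hq₁)) ?_
      have h₁ := hmono _ (i + 1) (by omega)
        (hstep (i + 1) (Finset.mem_Icc.2 ⟨by omega, hi⟩) l hl q₂ hq₂)
      have h₂ := hmulCast _ q₂ (mIdx n (Q (i + 1)) l) (hle (i + 1) (i + 1) (by omega) le_rfl hq₂)
      have h₃ := add_mem h₁ h₂
      rwa [mul_sub, sub_add_cancel] at h₃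
  refine ⟨⟨by simp [Fi], hmono, ?_⟩, hinv, ?_⟩
  · obtain ⟨K, hK, hKl, -, hKn⟩ := exists_lacunar_nonShadow_subset n (Finset.Icc 1 n)
    obtain ⟨j, ⟨hj, rfl⟩, -⟩ := hQbij K hK hKl
    rw [Finset.mem_Icc] at hj
    refine eq_top_iff.2 (le_trans ?_ (hle _ j hj.1 hj.2))
    intro q _ i hi
    have := mem_nonShadow.1 (hKn hi)
    simp only [Finset.mem_Icc] at this
    omega
  · intro i hi l hl q hq
    obtain ⟨i, rfl⟩ : ∃ i', i = i' + 1 := ⟨i - 1, by have := (Finset.mem_Icc.1 hi).1; omega⟩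
    rw [hsucc] at hq
    obtain ⟨q₁, hq₁, q₂, hq₂, rfl⟩ := Submodule.mem_sup.1 hq
    rw [add_mul]
    refine add_mem ?_ (hstep _ hi l hl q₂ hq₂)
    rw [Nat.add_sub_cancel, mul_sub]
    have := (Finset.mem_Icc.1 hi).2
    exact sub_mem (hinv i (by omega) l hl q₁ hq₁) (hmulCast _ _ _ hq₁)

end OneSidedCycleShuffles
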